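/- There is a universal constant C > 0 such that for all integers n, T ≥ 2, every nonempty finite set S ⊂ ℝ^n of test vectors of Euclidean norm at most 1, and every probability distribution p on ℝ^n supported on the closed Euclidean unit ball, there exists an online signing algorithm (a family of measurable maps χ_t : (ℝ^n)^t × [0,1]^t → {−1,+1}) such that, when v_1,…,v_T are i.i.d. with law p and u_1,…,u_T are independent i.i.d. uniform seeds, with probability at least 1 − C/T the discrepancy vectors d_t = Σ_{s=1}^t χ_s v_s satisfy max_{z ∈ S} |⟨d_t, z⟩| ≤ C·(log|S| + log T)·(log(nT))^3 for every t ∈ {1,…,T}. -/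

import Mathlib

open MeasureTheory Real

noncomputable section

namespace SelfBalancingWalk

variable {n : ℕ}

/-- The sign chosen at position `w` on arrival of `v` with seed `u`: it is `1` with probability
`1/2 - ⟨w, v⟩ / (2c)` whenever `|⟨w, v⟩| ≤ c`. -/
def stepSign (c : ℝ) (w v : Fin n → ℝ) (u : ℝ) : ℝ :=
  if u ≤ (1 - w ⬝ᵥ v / c) / 2 then 1 else -1

/-- The self-balancing walk started at `w`. -/
def walk (c : ℝ) (w : Fin n → ℝ) (v : ℕ → Fin n → ℝ) (u : ℕ → ℝ) : ℕ → Fin n → ℝ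
  | 0 => w
  | k + 1 => walk c w v u k + stepSign c (walk c w v u k) (v k) (u k) • v k

/-- The walk has not yet seen an incoming vector with which its inner product exceeds `c`. -/
def Stable (c : ℝ) (w : Fin n → ℝ) (v : ℕ → Fin n → ℝ) (u : ℕ → ℝ) (k : ℕ) : Prop :=
  ∀ j < k, |walk c w v u j ⬝ᵥ v j| ≤ c

/-- Extension of a finite sequence by zero. -/
def zeroExtend {α : Type*} [Zero α] {T : ℕ} (x : Fin T → α) (j : ℕ) : α :=
  if h : j < T then x ⟨j, h⟩ else 0

lemma zeroExtend_cons_zero {α : Type*} [Zero α] {T : ℕ} (a : α) (x : Fin T → α) :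
    zeroExtend (Fin.cons a x : Fin (T + 1) → α) 0 = a := by
  simp [zeroExtend]

lemma zeroExtend_cons_succ {α : Type*} [Zero α] {T : ℕ} (a : α) (x : Fin T → α) (j : ℕ) :
    zeroExtend (Fin.cons a x : Fin (T + 1) → α) (j + 1) = zeroExtend x j := by
  by_cases h : j < T
  · simp only [zeroExtend, h, Nat.succ_lt_succ_iff, dite_true]
    exact Fin.cons_succ (α := fun _ => α) a x ⟨j, h⟩
  · simp [zeroExtend, h]

lemma measurable_zeroExtend {α : Type*} [Zero α] [MeasurableSpace α] {T : ℕ} :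
    Measurable (zeroExtend : (Fin T → α) → ℕ → α) := by
  refine measurable_pi_lambda _ fun j => ?_
  by_cases h : j < T
  · simpa [zeroExtend, h] using measurable_pi_apply _
  · simp [zeroExtend, h]

lemma stepSign_eq_or (c : ℝ) (w v : Fin n → ℝ) (u : ℝ) :
    stepSign c w v u = 1 ∨ stepSign c w v u = -1 := by
  unfold stepSign; split_ifs <;> simp

lemma measurable_dotProduct {α : Type*} [MeasurableSpace α] {f g : α → Fin n → ℝ}
    (hf : Measurable f) (hg : Measurable g) : Measurable fun a => f a ⬝ᵥ g a := by
  unfold dotProduct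
  fun_prop

lemma measurable_stepSign {α : Type*} [MeasurableSpace α] (c : ℝ) {w v : α → Fin n → ℝ} {u : α → ℝ}
    (hw : Measurable w) (hv : Measurable v) (hu : Measurable u) :
    Measurable fun a => stepSign c (w a) (v a) (u a) := by
  unfold stepSign
  refine Measurable.ite (measurableSet_le hu ?_) measurable_const measurable_const
  exact (((measurable_dotProduct hw hv).div_const c).const_sub 1).div_const 2

lemma measurable_walk {α : Type*} [MeasurableSpace α] (c : ℝ) (w : Fin n → ℝ)
    {v : α → ℕ → Fin n → ℝ} {u : α → ℕ → ℝ} (hv : Measurable v) (hu : Measurable u) (k : ℕ) :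
    Measurable fun a => walk c w (v a) (u a) k := by
  induction k with
  | zero => exact measurable_const
  | succ k ih =>
    have hvk : Measurable fun a => v a k := (measurable_pi_apply k).comp hv
    have huk : Measurable fun a => u a k := (measurable_pi_apply k).comp hu
    exact ih.add ((measurable_stepSign c ih hvk huk).smul hvk)

lemma walk_congr (c : ℝ) (w : Fin n → ℝ) {v v' : ℕ → Fin n → ℝ} {u u' : ℕ → ℝ} {k : ℕ}
    (hv : ∀ j < k, v j = v' j) (hu : ∀ j < k, u j = u' j) :
    walk c w v u k = walk c w v' u' k := by
  induction k with
  | zero => rfl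
  | succ k ih =>
    simp only [walk, ih (fun j hj => hv j (by omega)) (fun j hj => hu j (by omega)),
      hv k (by omega), hu k (by omega)]

lemma walk_succ_eq_walk_shift (c : ℝ) (w : Fin n → ℝ) (v : ℕ → Fin n → ℝ) (u : ℕ → ℝ) (k : ℕ) :
    walk c w v u (k + 1) =
      walk c (w + stepSign c w (v 0) (u 0) • v 0) (fun j => v (j + 1)) (fun j => u (j + 1)) k := by
  induction k with
  | zero => rfl
  | succ k ih => rw [walk, ih]; rfl

lemma stable_succ_iff_shift (c : ℝ) (w : Fin n → ℝ) (v : ℕ → Fin n → ℝ) (u : ℕ → ℝ) (k : ℕ) :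
    Stable c w v u (k + 1) ↔ |w ⬝ᵥ v 0| ≤ c ∧
      Stable c (w + stepSign c w (v 0) (u 0) • v 0) (fun j => v (j + 1)) (fun j => u (j + 1)) k := by
  simp only [Stable, Nat.forall_lt_succ_left, walk_succ_eq_walk_shift]
  rfl

lemma walk_eq_sum (c : ℝ) (v : ℕ → Fin n → ℝ) (u : ℕ → ℝ) (k : ℕ) :
    walk c 0 v u k = ∑ j ∈ Finset.range k, stepSign c (walk c 0 v u j) (v j) (u j) • v j := by
  induction k with
  | zero => rfl
  | succ k ih => rw [Finset.sum_range_succ, ← ih]; rfl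

/-- The uniform law on the unit interval. -/
abbrev unif : Measure ℝ := volume.restrict (Set.Icc (0 : ℝ) 1)

instance : IsProbabilityMeasure unif := ⟨by simp⟩

lemma integral_stepSign {c : ℝ} (hc : 0 < c) {w v : Fin n → ℝ} (h : |w ⬝ᵥ v| ≤ c) :
    ∫ u, stepSign c w v u ∂unif = -(w ⬝ᵥ v / c) := by
  set x := w ⬝ᵥ v / c with hx
  have hx1 : |x| ≤ 1 := by rw [hx, abs_div, abs_of_pos hc]; exact (div_le_one hc).2 h
  obtain ⟨h1, h2⟩ := abs_le.1 hx1
  have hs : (fun u => stepSign c w v u) =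
      fun u => (Set.Iic ((1 - x) / 2)).indicator (fun _ => (2 : ℝ)) u - 1 := by
    funext u
    by_cases hu : u ≤ (1 - x) / 2
    · simp [stepSign, ← hx, hu]; norm_num
    · simp [stepSign, ← hx, hu]
  have hI : Set.Iic ((1 - x) / 2) ∩ Set.Icc 0 1 = Set.Icc 0 ((1 - x) / 2) := by
    ext y; simp only [Set.mem_inter_iff, Set.mem_Iic, Set.mem_Icc]
    constructor
    · rintro ⟨a, b, -⟩; exact ⟨b, a⟩
    · rintro ⟨a, b⟩; exact ⟨b, a, by linarith⟩
  rw [hs, integral_sub ((integrable_const _).indicator measurableSet_Iic) (integrable_const _),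
    integral_indicator_const _ measurableSet_Iic, Measure.real,
    Measure.restrict_apply measurableSet_Iic, hI]
  simp only [volume_Icc, integral_const, probReal_univ, smul_eq_mul]
  rw [ENNReal.toReal_ofReal (by linarith)]
  ring

lemma lintegral_exp_step_le {c : ℝ} (hc : 1 ≤ c) {w v : Fin n → ℝ} (hv : v ⬝ᵥ v ≤ 1)
    (h : |w ⬝ᵥ v| ≤ c) (φ : Fin n → ℝ) :
    ∫⁻ u, ENNReal.ofReal (exp ((w + stepSign c w v u • v) ⬝ᵥ φ + c / 2 * -(φ ⬝ᵥ φ))) ∂unif ≤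
      ENNReal.ofReal (exp (w ⬝ᵥ (φ - (v ⬝ᵥ φ / c) • v) +
        c / 2 * -((φ - (v ⬝ᵥ φ / c) • v) ⬝ᵥ (φ - (v ⬝ᵥ φ / c) • v)))) := by
  have hc0 : 0 < c := by linarith
  set b := v ⬝ᵥ φ with hb
  have hsg := ProbabilityTheory.hasSubgaussianMGF_of_mem_Icc (μ := unif)
    (X := fun u => stepSign c w v u) (a := -1) (b := 1)
    (measurable_stepSign c measurable_const measurable_const measurable_id).aemeasurable
    (Filter.Eventually.of_forall fun u => by
      rcases stepSign_eq_or c w v u with h | h <;> simp [h])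
  rw [integral_stepSign hc0 h] at hsg
  have hint := hsg.integrable_exp_mul b
  have hle := hsg.mgf_le b
  rw [ProbabilityTheory.mgf] at hle
  set K := w ⬝ᵥ φ - b * (w ⬝ᵥ v / c) + c / 2 * -(φ ⬝ᵥ φ) with hK
  have hfun : ∀ u, exp ((w + stepSign c w v u • v) ⬝ᵥ φ + c / 2 * -(φ ⬝ᵥ φ)) =
      exp K * exp (b * (stepSign c w v u - -(w ⬝ᵥ v / c))) := by
    intro u
    rw [← exp_add, add_dotProduct, smul_dotProduct, ← hb, smul_eq_mul, hK]
    congr 1; ring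
  simp_rw [hfun]
  rw [← ofReal_integral_eq_lintegral_ofReal (hint.const_mul _)
    (Filter.Eventually.of_forall fun u => by positivity), integral_const_mul]
  refine ENNReal.ofReal_le_ofReal ((mul_le_mul_of_nonneg_left hle (exp_pos _).le).trans ?_)
  rw [← exp_add, exp_le_exp]
  have hcoef : (((‖(1 : ℝ) - -1‖₊ / 2) ^ 2 : NNReal) : ℝ) = 1 := by
    push_cast; norm_num
  rw [hcoef]
  simp only [dotProduct_sub, sub_dotProduct, dotProduct_smul, smul_dotProduct, smul_eq_mul,
    dotProduct_comm φ v, ← hb, hK]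
  have hkey : c / 2 * (b / c * (b / c * (v ⬝ᵥ v))) ≤ b ^ 2 / 2 := by
    have : c / 2 * (b / c * (b / c * (v ⬝ᵥ v))) = b ^ 2 / 2 * ((v ⬝ᵥ v) / c) := by
      field_simp
    rw [this]
    exact mul_le_of_le_one_right (by positivity) ((div_le_one hc0).2 (hv.trans hc))
  have h2 : c / 2 * (b / c * b) = b ^ 2 / 2 := by field_simp
  have h3 : b * (w ⬝ᵥ v / c) = b / c * (w ⬝ᵥ v) := by ring
  linarith

lemma measurableSet_stable {α : Type*} [MeasurableSpace α] (c : ℝ) (w : Fin n → ℝ)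
    {v : α → ℕ → Fin n → ℝ} {u : α → ℕ → ℝ} (hv : Measurable v) (hu : Measurable u) (k : ℕ) :
    MeasurableSet {a | Stable c w (v a) (u a) k} := by
  have : {a | Stable c w (v a) (u a) k} =
      ⋂ j, ⋂ (_ : j < k), {a | |walk c w (v a) (u a) j ⬝ᵥ v a j| ≤ c} := by
    ext; simp [Stable]
  rw [this]
  refine MeasurableSet.iInter fun j => MeasurableSet.iInter fun _ => measurableSet_le ?_
    measurable_const
  exact (measurable_dotProduct (measurable_walk c w hv hu j)
    ((measurable_pi_apply j).comp hv)).abs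

lemma lintegral_pi_succ {T : ℕ} (μ : Measure ℝ) [SigmaFinite μ] {f : (Fin (T + 1) → ℝ) → ENNReal}
    (hf : Measurable f) :
    ∫⁻ x, f x ∂(Measure.pi fun _ => μ) =
      ∫⁻ a, ∫⁻ y, f (Fin.cons a y) ∂(Measure.pi fun _ : Fin T => μ) ∂μ := by
  have hmp := (measurePreserving_piFinSuccAbove (fun _ : Fin (T + 1) => μ) 0).symm
  rw [← hmp.lintegral_comp hf, lintegral_prod (fun x => f _) (hf.comp hmp.measurable).aemeasurable]
  simp [MeasurableEquiv.piFinSuccAbove_symm_apply, Fin.insertNthEquiv]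

/-- Along stable trajectories the walk is sub-Gaussian with variance proxy `c`; the vector `φ` tracks
the dependence on the starting point, which is what makes the induction close. -/
lemma exists_lintegral_exp_walk_le {c : ℝ} (hc : 1 ≤ c) (θ : Fin n → ℝ) (T : ℕ) :
    ∀ (k : ℕ) (v : ℕ → Fin n → ℝ), k ≤ T → (∀ j < k, v j ⬝ᵥ v j ≤ 1) →
      ∃ φ : Fin n → ℝ, ∀ w : Fin n → ℝ,
        ∫⁻ u, {u | Stable c w v (zeroExtend u) k}.indicator
          (fun u => ENNReal.ofReal (exp (walk c w v (zeroExtend u) k ⬝ᵥ θ + c / 2 * -(θ ⬝ᵥ θ)))) u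
          ∂(Measure.pi fun _ : Fin T => unif) ≤
        ENNReal.ofReal (exp (w ⬝ᵥ φ + c / 2 * -(φ ⬝ᵥ φ))) := by
  have hzero : ∀ (T : ℕ) (v : ℕ → Fin n → ℝ), ∃ φ : Fin n → ℝ, ∀ w : Fin n → ℝ,
        ∫⁻ u, {u | Stable c w v (zeroExtend u) 0}.indicator
          (fun u => ENNReal.ofReal (exp (walk c w v (zeroExtend u) 0 ⬝ᵥ θ + c / 2 * -(θ ⬝ᵥ θ)))) u
          ∂(Measure.pi fun _ : Fin T => unif) ≤
        ENNReal.ofReal (exp (w ⬝ᵥ φ + c / 2 * -(φ ⬝ᵥ φ))) := fun T v =>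
    ⟨θ, fun w => by simp [Stable, walk]⟩
  induction T with
  | zero =>
    intro k v hk _
    obtain rfl : k = 0 := by omega
    exact hzero 0 v
  | succ T ih =>
    intro k v hk hv
    rcases k with _ | k
    · exact hzero _ v
    obtain ⟨φ, hφ⟩ := ih k (fun j => v (j + 1)) (by omega) fun j hj => hv (j + 1) (by omega)
    refine ⟨φ - (v 0 ⬝ᵥ φ / c) • v 0, fun w => ?_⟩
    rw [lintegral_pi_succ]
    swap
    · refine Measurable.indicator ?_
        (measurableSet_stable c w measurable_const measurable_zeroExtend _)
      exact (((measurable_dotProduct (measurable_walk c w measurable_const measurable_zeroExtend _)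
        measurable_const).add_const _).exp).ennreal_ofReal
    by_cases hw : |w ⬝ᵥ v 0| ≤ c
    · refine le_trans (lintegral_mono fun a => ?_)
        (lintegral_exp_step_le hc (hv 0 (by omega)) hw φ)
      refine le_trans (le_of_eq (lintegral_congr fun u => ?_))
        (hφ (w + stepSign c w (v 0) a • v 0))
      have hshift : (fun j => zeroExtend (Fin.cons a u : Fin (T + 1) → ℝ) (j + 1)) = zeroExtend u :=
        funext (zeroExtend_cons_succ a u)
      have hst : Stable c w v (zeroExtend (Fin.cons a u : Fin (T + 1) → ℝ)) (k + 1) ↔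
          Stable c (w + stepSign c w (v 0) a • v 0) (fun j => v (j + 1)) (zeroExtend u) k := by
        rw [stable_succ_iff_shift, hshift, zeroExtend_cons_zero, and_iff_right hw]
      by_cases hs : Stable c w v (zeroExtend (Fin.cons a u : Fin (T + 1) → ℝ)) (k + 1)
      · refine (Set.indicator_of_mem (s := {u | Stable c w v (zeroExtend u) (k + 1)}) hs _).trans
          (Eq.trans ?_ (Set.indicator_of_mem (s := {u | Stable c (w + stepSign c w (v 0) a • v 0)
            (fun j => v (j + 1)) (zeroExtend u) k}) (hst.1 hs) _).symm)
        rw [walk_succ_eq_walk_shift, hshift, zeroExtend_cons_zero]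
      · exact (Set.indicator_of_notMem (s := {u | Stable c w v (zeroExtend u) (k + 1)}) hs _).trans
          (Set.indicator_of_notMem (s := {u | Stable c (w + stepSign c w (v 0) a • v 0)
            (fun j => v (j + 1)) (zeroExtend u) k}) (mt hst.2 hs) _).symm
    · simp [stable_succ_iff_shift, hw]

lemma measure_stable_and_lt_le {c : ℝ} (hc : 1 ≤ c) {T k : ℕ} (hk : k ≤ T)
    {v : ℕ → Fin n → ℝ} (hv : ∀ j < k, v j ⬝ᵥ v j ≤ 1) {z : Fin n → ℝ} (hz : z ⬝ᵥ z ≤ 1) :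
    (Measure.pi fun _ : Fin T => unif)
      {u | Stable c 0 v (zeroExtend u) k ∧ c < walk c 0 v (zeroExtend u) k ⬝ᵥ z} ≤
        ENNReal.ofReal (exp (-(c / 2))) := by
  obtain ⟨φ, hφ⟩ := exists_lintegral_exp_walk_le hc z T k v hk hv
  have h0 : exp ((0 : Fin n → ℝ) ⬝ᵥ φ + c / 2 * -(φ ⬝ᵥ φ)) ≤ 1 := by
    rw [exp_le_one_iff, zero_dotProduct]
    have : 0 ≤ φ ⬝ᵥ φ := Finset.sum_nonneg fun i _ => mul_self_nonneg _
    nlinarith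
  have hle := (hφ 0).trans (ENNReal.ofReal_le_ofReal h0)
  set μ := Measure.pi fun _ : Fin T => unif
  set A := {u : Fin T → ℝ | Stable c 0 v (zeroExtend u) k ∧ c < walk c 0 v (zeroExtend u) k ⬝ᵥ z}
  have hA : MeasurableSet A :=
    (measurableSet_stable c 0 measurable_const measurable_zeroExtend k).inter
      (measurableSet_lt measurable_const (measurable_dotProduct
        (measurable_walk c 0 measurable_const measurable_zeroExtend k) measurable_const))
  have hlow : ENNReal.ofReal (exp (c / 2)) * μ A ≤ ENNReal.ofReal 1 := by
    rw [← lintegral_indicator_const hA]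
    refine (lintegral_mono fun u => ?_).trans hle
    by_cases hu : u ∈ A
    · rw [Set.indicator_of_mem hu,
        Set.indicator_of_mem (show u ∈ {u | Stable c 0 v (zeroExtend u) k} from hu.1)]
      refine ENNReal.ofReal_le_ofReal (exp_le_exp.2 ?_)
      have := hu.2
      nlinarith
    · simp [Set.indicator_of_notMem hu]
  have hexp : ENNReal.ofReal (exp (-(c / 2))) * ENNReal.ofReal (exp (c / 2)) = 1 := by
    rw [← ENNReal.ofReal_mul (exp_pos _).le, ← exp_add]
    simp
  calc μ A = ENNReal.ofReal (exp (-(c / 2))) * (ENNReal.ofReal (exp (c / 2)) * μ A) := by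
        rw [← mul_assoc, hexp, one_mul]
    _ ≤ ENNReal.ofReal (exp (-(c / 2))) * ENNReal.ofReal 1 := by gcongr
    _ = _ := by simp

lemma measure_stable_and_lt_abs_le {c : ℝ} (hc : 1 ≤ c) {T k : ℕ} (hk : k ≤ T)
    {v : ℕ → Fin n → ℝ} (hv : ∀ j, v j ⬝ᵥ v j ≤ 1) {z : Fin n → ℝ} (hz : z ⬝ᵥ z ≤ 1) :
    (Measure.pi fun _ : Fin T => unif)
      {u | Stable c 0 v (zeroExtend u) k ∧ c < |walk c 0 v (zeroExtend u) k ⬝ᵥ z|} ≤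
        ENNReal.ofReal (2 * exp (-(c / 2))) := by
  have hz' : -z ⬝ᵥ -z ≤ 1 := by simpa using hz
  rw [two_mul, ENNReal.ofReal_add (exp_pos _).le (exp_pos _).le]
  refine le_trans ((measure_mono ?_).trans (measure_union_le _ _))
    (add_le_add (measure_stable_and_lt_le hc hk (fun j _ => hv j) hz)
      (measure_stable_and_lt_le hc hk (fun j _ => hv j) hz'))
  rintro u ⟨hs, hu⟩
  rcases lt_abs.1 hu with h | h
  · exact Or.inl ⟨hs, h⟩
  · exact Or.inr ⟨hs, by rwa [dotProduct_neg]⟩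

/-- The self-balancing walk stays within `c` in every test direction, up to a union bound. -/
lemma measure_exists_lt_abs_walk_le {c : ℝ} (hc : 1 ≤ c) (T : ℕ)
    {v : ℕ → Fin n → ℝ} (hv : ∀ j, v j ⬝ᵥ v j ≤ 1) {S : Finset (Fin n → ℝ)}
    (hS : ∀ z ∈ S, z ⬝ᵥ z ≤ 1) :
    (Measure.pi fun _ : Fin T => unif)
      {u | ∃ k ≤ T, ∃ z ∈ S, c < |walk c 0 v (zeroExtend u) k ⬝ᵥ z|} ≤
        ENNReal.ofReal ((T + 1) * (S.card + 1) * (2 * exp (-(c / 2)))) := by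
  classical
  have hsub : {u : Fin T → ℝ | ∃ k ≤ T, ∃ z ∈ S, c < |walk c 0 v (zeroExtend u) k ⬝ᵥ z|} ⊆
      ⋃ k ∈ Finset.range (T + 1), ⋃ z ∈ insert (v k) S,
        {u | Stable c 0 v (zeroExtend u) k ∧ c < |walk c 0 v (zeroExtend u) k ⬝ᵥ z|} := by
    rintro u ⟨k, hk, z, hz, hlt⟩
    by_contra hu
    simp only [Set.mem_iUnion, Finset.mem_range, Set.mem_ofPred_eq, not_exists, not_and,
      not_lt] at hu
    have hst : ∀ j ≤ T, Stable c 0 v (zeroExtend u) j := by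
      intro j
      induction j with
      | zero => intro _ i hi; omega
      | succ j ih =>
        intro hj i hi
        rcases Nat.lt_succ_iff_lt_or_eq.1 hi with h | rfl
        · exact ih (by omega) i h
        · exact hu i (by omega) (v i) (Finset.mem_insert_self _ _) (ih (by omega))
    exact absurd (hu k (by omega) z (Finset.mem_insert_of_mem hz) (hst k hk)) (not_le.2 hlt)
  set e := 2 * exp (-(c / 2))
  have he0 : 0 ≤ e := by positivity
  refine (measure_mono hsub).trans ((measure_biUnion_finset_le _ _).trans ?_)
  have hk : ∀ k ∈ Finset.range (T + 1), (Measure.pi fun _ : Fin T => unif)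
      (⋃ z ∈ insert (v k) S,
        {u | Stable c 0 v (zeroExtend u) k ∧ c < |walk c 0 v (zeroExtend u) k ⬝ᵥ z|}) ≤
      ENNReal.ofReal ((S.card + 1) * e) := by
    intro k hk
    refine (measure_biUnion_finset_le _ _).trans ((Finset.sum_le_card_nsmul _ _
      (ENNReal.ofReal e) fun z hz => ?_).trans ?_)
    · refine measure_stable_and_lt_abs_le hc (by simpa [Nat.lt_succ_iff] using hk) hv ?_
      rcases Finset.mem_insert.1 hz with rfl | h
      · exact hv k
      · exact hS z h
    · rw [← ENNReal.ofReal_nsmul, nsmul_eq_mul]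
      refine ENNReal.ofReal_le_ofReal (mul_le_mul_of_nonneg_right ?_ he0)
      exact_mod_cast Finset.card_insert_le (v k) S
  refine (Finset.sum_le_card_nsmul _ _ _ hk).trans (le_of_eq ?_)
  rw [← ENNReal.ofReal_nsmul, nsmul_eq_mul, Finset.card_range]
  push_cast
  ring_nf

lemma dotProduct_self_le_one {z : Fin n → ℝ} (hz : √(∑ i, z i ^ 2) ≤ 1) : z ⬝ᵥ z ≤ 1 := by
  have := Real.sqrt_le_one.1 hz
  simpa [dotProduct, sq] using this

lemma zeroExtend_castLE {α : Type*} [Zero α] {T : ℕ} (s : Fin T) (x : Fin T → α) {j : ℕ}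
    (hj : j < s.1 + 1) :
    zeroExtend (fun i : Fin (s.1 + 1) => x (Fin.castLE s.isLt i)) j = zeroExtend x j := by
  have hj' : j < T := by have := s.isLt; omega
  simp only [zeroExtend, hj, hj', dite_true]
  rfl

lemma union_bound_le {m T : ℕ} (hm : 1 ≤ m) (hT : 2 ≤ T) :
    ((T : ℝ) + 1) * (m + 1) * (2 * exp (-(4 * (log m + log T) / 2))) ≤ 6 / T := by
  have hm' : (1 : ℝ) ≤ m := by exact_mod_cast hm
  have hT' : (2 : ℝ) ≤ T := by exact_mod_cast hT
  have hexp : exp (-(4 * (log m + log T) / 2)) = 1 / ((m * T) ^ 2 : ℝ) := by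
    rw [← log_mul (by positivity) (by positivity),
      show -(4 * log (m * T : ℝ) / 2) = -(log (m * T) * (2 : ℕ)) by push_cast; ring, exp_neg,
      mul_comm (log _), exp_nat_mul, exp_log (by positivity), one_div]
  rw [hexp, mul_one_div, mul_div_assoc', div_le_div_iff₀ (by positivity) (by positivity)]
  have h1 : ((T : ℝ) + 1) * (m + 1) * 2 ≤ 6 * (m ^ 2 * T) := by
    have : (m : ℝ) ≤ m ^ 2 := by nlinarith
    nlinarith
  nlinarith

end SelfBalancingWalk

end

open SelfBalancingWalk

/-- **Discrepancy for arbitrary test directions** (Theorem 1.3).  There is a universal constant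
`C > 0` such that for all `n, T ≥ 2`, every nonempty finite set `S ⊆ ℝ^n` of test vectors of
Euclidean norm at most `1`, and every probability distribution `p` on `ℝ^n` supported on the
closed Euclidean unit ball, there is an online signing algorithm such that with probability at
least `1 - C/T` the discrepancy vectors satisfy
`max_{z ∈ S} |⟨d_t, z⟩| ≤ C (log |S| + log T) (log (nT))^3` for all `t`. -/
theorem online_discrepancy_arbitrary_test_vectors :
    ∃ C : ℝ, 0 < C ∧
      ∀ (n T : ℕ), 2 ≤ n → 2 ≤ T →
      ∀ (S : Finset (Fin n → ℝ)), S.Nonempty → (∀ z ∈ S, Real.sqrt (∑ i, z i ^ 2) ≤ 1) →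
      ∀ (p : Measure (Fin n → ℝ)) [IsProbabilityMeasure p],
      (∀ᵐ v ∂p, Real.sqrt (∑ i, v i ^ 2) ≤ 1) →
      ∃ χ : (t : Fin T) → (Fin (t.1 + 1) → (Fin n → ℝ)) → (Fin (t.1 + 1) → ℝ) → ℝ,
        (∀ t, Measurable fun q : (Fin (t.1 + 1) → (Fin n → ℝ)) × (Fin (t.1 + 1) → ℝ) =>
            χ t q.1 q.2) ∧
        (∀ t v u, χ t v u = 1 ∨ χ t v u = -1) ∧
        ((Measure.pi fun _ : Fin T => p).prod
            (Measure.pi fun _ : Fin T => volume.restrict (Set.Icc (0:ℝ) 1)))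
          {ω : (Fin T → (Fin n → ℝ)) × (Fin T → ℝ) |
            ∀ t : Fin T, ∀ z ∈ S,
              |∑ i, (∑ s ∈ Finset.Iic t,
                  χ s (fun j => ω.1 (Fin.castLE s.isLt j)) (fun j => ω.2 (Fin.castLE s.isLt j))
                    • ω.1 s) i * z i|
                ≤ C * (Real.log (S.card : ℝ) + Real.log (T : ℝ)) * Real.log ((n : ℝ) * T) ^ 3 } ≥
          ENNReal.ofReal (1 - C / T) := by
  refine ⟨6, by norm_num, fun n T hn hT S hS hSn p _ hp => ?_⟩
  set c : ℝ := 4 * (log S.card + log T) with hcdef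
  have hT' : (2 : ℝ) ≤ T := by exact_mod_cast hT
  have hn' : (2 : ℝ) ≤ n := by exact_mod_cast hn
  have hlogS : 0 ≤ log S.card := log_natCast_nonneg _
  have hlogT : log 2 ≤ log T := log_le_log (by norm_num) hT'
  have hlog2 := log_two_gt_d9
  have hc : 1 ≤ c := by linarith
  have hlog : 1 ≤ log (n * T) := by
    rw [log_mul (by positivity) (by positivity)]
    have : log 2 ≤ log n := log_le_log (by norm_num) hn'
    linarith
  have hbound : c ≤ 6 * (log S.card + log T) * log (n * T) ^ 3 := by
    have : 1 ≤ log (n * T) ^ 3 := one_le_pow₀ hlog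
    nlinarith
  refine ⟨fun t v u => stepSign c (walk c 0 (zeroExtend v) (zeroExtend u) t)
      (v (Fin.last _)) (u (Fin.last _)),
    fun t => ?_, fun t v u => stepSign_eq_or _ _ _ _, ?_⟩
  · exact measurable_stepSign c
      (measurable_walk c 0 (measurable_zeroExtend.comp measurable_fst)
        (measurable_zeroExtend.comp measurable_snd) _)
      ((measurable_pi_apply _).comp measurable_fst) ((measurable_pi_apply _).comp measurable_snd)
  set ρ := (Measure.pi fun _ : Fin T => p).prod (Measure.pi fun _ : Fin T => unif) with hρ
  set bad : Set ((Fin T → Fin n → ℝ) × (Fin T → ℝ)) :=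
    {ω | ∃ k ≤ T, ∃ z ∈ S, c < |walk c 0 (zeroExtend ω.1) (zeroExtend ω.2) k ⬝ᵥ z|} with hbad
  have hmeas : MeasurableSet bad := by
    have : bad = ⋃ k, ⋃ (_ : k ≤ T), ⋃ z ∈ S,
        {ω | c < |walk c 0 (zeroExtend ω.1) (zeroExtend ω.2) k ⬝ᵥ z|} := by
      ext; simp [hbad]
    rw [this]
    refine MeasurableSet.iUnion fun k => MeasurableSet.iUnion fun _ =>
      Finset.measurableSet_biUnion _ fun z _ => measurableSet_lt measurable_const ?_
    exact (measurable_dotProduct (measurable_walk c 0 (measurable_zeroExtend.comp measurable_fst)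
      (measurable_zeroExtend.comp measurable_snd) k) measurable_const).abs
  have hbadle : ρ bad ≤ ENNReal.ofReal (6 / T) := by
    rw [hρ, Measure.prod_apply hmeas]
    have hae : ∀ᵐ v ∂(Measure.pi fun _ : Fin T => p), ∀ i, v i ⬝ᵥ v i ≤ 1 :=
      ae_all_iff.2 fun i => (Measure.quasiMeasurePreserving_eval (fun _ : Fin T => p) i).ae
        (hp.mono fun v hv => dotProduct_self_le_one hv)
    have hslice : ∀ᵐ v ∂(Measure.pi fun _ : Fin T => p),
        (Measure.pi fun _ : Fin T => unif) (Prod.mk v ⁻¹' bad) ≤ ENNReal.ofReal (6 / T) := by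
      filter_upwards [hae] with v hv
      have hv' : ∀ j, zeroExtend v j ⬝ᵥ zeroExtend v j ≤ 1 := by
        intro j
        by_cases h : j < T
        · simpa [zeroExtend, h] using hv ⟨j, h⟩
        · simp [zeroExtend, h]
      exact (measure_exists_lt_abs_walk_le hc T hv'
        fun z hz => dotProduct_self_le_one (hSn z hz)).trans
        (ENNReal.ofReal_le_ofReal (union_bound_le hS.card_pos hT))
    refine (lintegral_mono_ae hslice).trans (le_of_eq ?_)
    simp
  have hgood : ENNReal.ofReal (1 - 6 / T) ≤ ρ badᶜ := by
    rw [prob_compl_eq_one_sub hmeas, ENNReal.ofReal_sub _ (by positivity), ENNReal.ofReal_one]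
    exact tsub_le_tsub_left hbadle 1
  refine hgood.trans (measure_mono fun ω hω t z hz => ?_)
  have hle : |walk c 0 (zeroExtend ω.1) (zeroExtend ω.2) (t + 1) ⬝ᵥ z| ≤ c := by
    by_contra hlt
    exact hω ⟨t + 1, t.isLt, z, hz, not_le.1 hlt⟩
  refine le_trans (le_of_eq ?_) (hle.trans hbound)
  have hsum : walk c 0 (zeroExtend ω.1) (zeroExtend ω.2) (t + 1) = ∑ s ∈ Finset.Iic t,
      stepSign c (walk c 0 (zeroExtend fun j => ω.1 (Fin.castLE s.isLt j))
        (zeroExtend fun j => ω.2 (Fin.castLE s.isLt j)) s)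
        (ω.1 (Fin.castLE s.isLt (Fin.last _))) (ω.2 (Fin.castLE s.isLt (Fin.last _))) • ω.1 s := by
    rw [walk_eq_sum, Nat.range_succ_eq_Iic, ← Fin.map_valEmbedding_Iic, Finset.sum_map]
    refine Finset.sum_congr rfl fun s _ => ?_
    rw [walk_congr c 0 (v' := zeroExtend ω.1) (u' := zeroExtend ω.2)
      (fun j hj => zeroExtend_castLE s ω.1 (Nat.lt_succ_of_lt hj))
      (fun j hj => zeroExtend_castLE s ω.2 (Nat.lt_succ_of_lt hj))]
    have hs : Fin.castLE s.isLt (Fin.last s.1) = s := rfl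
    simp [zeroExtend, hs]
  rw [hsum]
  rfl
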